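/- Let u₀ : ℝ → ℝ be bounded and continuous, let 1 ≤ p < ∞ and let K ⊆ ℝ² be compact. Then ∫_{Ω×K} |u₀(Γ^{(N)}(ω; 0; x, t)) − u₀(Γ(ω; 0; x, t))|^p d(P ⊗ λ)(ω, x, t) → 0 as N → ∞. -/

import Mathlib

open Filter Topology MeasureTheory Set

/-- Generalized inverse: `geninv f x = inf {t : f t ≥ x}`. -/
noncomputable def geninv (f : ℝ → ℝ) (x : ℝ) : ℝ := sInf {t : ℝ | x ≤ f t}

/-- Piecewise affine interpolation of `ξ` through the dyadic grid points
`(k/2^N, ξ(k/2^N))`, `k ∈ ℤ`. -/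
noncomputable def dyadicInterp (ξ : ℝ → ℝ) (N : ℕ) (s : ℝ) : ℝ :=
  (((⌈s * 2 ^ N⌉ : ℤ) : ℝ) / 2 ^ N - s) * 2 ^ N
      * ξ ((((⌈s * 2 ^ N⌉ : ℤ) : ℝ) - 1) / 2 ^ N)
    + (1 - (((⌈s * 2 ^ N⌉ : ℤ) : ℝ) / 2 ^ N - s) * 2 ^ N)
      * ξ (((⌈s * 2 ^ N⌉ : ℤ) : ℝ) / 2 ^ N)

/-- Dominated convergence to zero needs no measurability of the sequence, since the Bochner
integral of a non-measurable function vanishes. -/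
theorem tendsto_integral_zero_of_dominated {α : Type*} [MeasurableSpace α] {μ : Measure α}
    {f : ℕ → α → ℝ} (bound : α → ℝ) (hbound : Integrable bound μ)
    (hle : ∀ n, ∀ᵐ a ∂μ, ‖f n a‖ ≤ bound a)
    (hlim : ∀ᵐ a ∂μ, Tendsto (fun n => f n a) atTop (𝓝 0)) :
    Tendsto (fun n => ∫ a, f n a ∂μ) atTop (𝓝 0) := by
  classical
  let g : ℕ → α → ℝ := fun n => if AEStronglyMeasurable (f n) μ then f n else 0
  have hg : ∀ n, ∫ a, f n a ∂μ = ∫ a, g n a ∂μ := by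
    intro n
    by_cases h : AEStronglyMeasurable (f n) μ
    · simp [g, h]
    · simp [g, h, integral_non_aestronglyMeasurable h]
  have hgf : ∀ n a, ‖g n a‖ ≤ ‖f n a‖ := by
    intro n a
    by_cases h : AEStronglyMeasurable (f n) μ <;> simp [g, h]
  simp_rw [hg]
  rw [← integral_zero α ℝ (μ := μ)]
  refine tendsto_integral_of_dominated_convergence bound (fun n => ?_) hbound (fun n => ?_) ?_
  · by_cases h : AEStronglyMeasurable (f n) μ
    · simp [g, h]
    · simp [g, h, aestronglyMeasurable_zero]
  · filter_upwards [hle n] with a ha using (hgf n a).trans ha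
  · filter_upwards [hlim] with a ha
    exact squeeze_zero_norm (fun n => hgf n a) (by simpa using ha.norm)

theorem dyadicInterp_mem_Icc {ξ : ℝ → ℝ} (hξ : Monotone ξ) (N : ℕ) (s : ℝ) :
    dyadicInterp ξ N s ∈ Icc (ξ (s - 1 / 2 ^ N)) (ξ (s + 1 / 2 ^ N)) := by
  have h2 : (0 : ℝ) < 2 ^ N := by positivity
  have hc1 := Int.le_ceil (s * 2 ^ N)
  have hc2 := Int.ceil_lt_add_one (s * 2 ^ N)
  unfold dyadicInterp
  generalize ((⌈s * 2 ^ N⌉ : ℤ) : ℝ) = c at *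
  have hw : (c / 2 ^ N - s) * 2 ^ N = c - s * 2 ^ N := by field_simp
  rw [hw]
  have h1 : ξ (s - 1 / 2 ^ N) ≤ ξ ((c - 1) / 2 ^ N) := by
    apply hξ
    rw [le_div_iff₀ h2, sub_mul, one_div, inv_mul_cancel₀ h2.ne']
    linarith
  have h3 : ξ (c / 2 ^ N) ≤ ξ (s + 1 / 2 ^ N) := by
    apply hξ
    rw [div_le_iff₀ h2, add_mul, one_div, inv_mul_cancel₀ h2.ne']
    linarith
  have h4 : ξ ((c - 1) / 2 ^ N) ≤ ξ (c / 2 ^ N) := by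
    apply hξ
    gcongr
    linarith
  constructor <;> nlinarith

section Path

variable {ξ : ℝ → ℝ}

theorem bddBelow_setOf_le (hξ : Monotone ξ) (hbot : Tendsto ξ atBot atBot) (x : ℝ) :
    BddBelow {t | x ≤ ξ t} := by
  obtain ⟨b, hb⟩ := (hbot.eventually_lt_atBot x).exists
  exact ⟨b, fun t ht => le_of_not_gt fun h => absurd (hξ h.le) (not_le.2 (hb.trans_le ht))⟩

theorem geninv_le_iff (hξ : Monotone ξ) (hright : ∀ s, ContinuousWithinAt ξ (Ici s) s)
    (htop : Tendsto ξ atTop atTop) (hbot : Tendsto ξ atBot atBot) (x s : ℝ) :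
    geninv ξ x ≤ s ↔ x ≤ ξ s := by
  refine ⟨fun h => ?_, fun h => csInf_le (bddBelow_setOf_le hξ hbot x) h⟩
  have hev : ∀ᶠ r in 𝓝[>] s, x ≤ ξ r := by
    filter_upwards [self_mem_nhdsWithin] with r hr
    obtain ⟨t, ht, htr⟩ := exists_lt_of_csInf_lt
      (htop.eventually_ge_atTop x).exists (h.trans_lt hr)
    exact le_trans ht (hξ htr.le)
  exact ge_of_tendsto ((hright s).mono_left (nhdsWithin_mono _ Ioi_subset_Ici_self)) hev

theorem geninv_dyadicInterp_mem_Icc (hξ : Monotone ξ) (htop : Tendsto ξ atTop atTop)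
    (hbot : Tendsto ξ atBot atBot) (N : ℕ) (x : ℝ) :
    geninv (dyadicInterp ξ N) x ∈ Icc (geninv ξ x - 1 / 2 ^ N) (geninv ξ x + 1 / 2 ^ N) := by
  have hne : {t | x ≤ ξ t}.Nonempty := (htop.eventually_ge_atTop x).exists
  have hbdd := bddBelow_setOf_le hξ hbot x
  have hshift : ∀ t, x ≤ ξ t → x ≤ dyadicInterp ξ N (t + 1 / 2 ^ N) := fun t ht => by
    have := (dyadicInterp_mem_Icc hξ N (t + 1 / 2 ^ N)).1
    rw [add_sub_cancel_right] at this
    exact ht.trans this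
  have hlow : ∀ t, x ≤ dyadicInterp ξ N t → geninv ξ x - 1 / 2 ^ N ≤ t := fun t ht => by
    have : geninv ξ x ≤ t + 1 / 2 ^ N :=
      csInf_le hbdd (ht.trans (dyadicInterp_mem_Icc hξ N t).2)
    linarith
  constructor
  · obtain ⟨t, ht⟩ := hne
    exact le_csInf ⟨_, hshift t ht⟩ hlow
  · rw [← sub_le_iff_le_add]
    refine le_csInf hne fun t ht => ?_
    rw [sub_le_iff_le_add]
    exact csInf_le ⟨_, hlow⟩ (hshift t ht)

theorem abs_dyadicInterp_geninv_sub_le (hξ : Monotone ξ) (htop : Tendsto ξ atTop atTop)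
    (hbot : Tendsto ξ atBot atBot) (N : ℕ) (x t : ℝ) :
    |dyadicInterp ξ N (0 + geninv (dyadicInterp ξ N) x - t) - ξ (0 + geninv ξ x - t)|
      ≤ ξ (geninv ξ x - t + 2 / 2 ^ N) - ξ (geninv ξ x - t - 2 / 2 ^ N) := by
  obtain ⟨h1, h2⟩ := geninv_dyadicInterp_mem_Icc hξ htop hbot N x
  obtain ⟨h3, h4⟩ := dyadicInterp_mem_Icc hξ N (0 + geninv (dyadicInterp ξ N) x - t)
  have h0 : (0 : ℝ) < 1 / 2 ^ N := by positivity
  have h5 : (2 : ℝ) / 2 ^ N = 1 / 2 ^ N + 1 / 2 ^ N := by ring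
  rw [h5]
  have h6 := h4.trans (hξ (show _ ≤ geninv ξ x - t + (1 / 2 ^ N + 1 / 2 ^ N) by linarith))
  have h7 := (hξ (show geninv ξ x - t - (1 / 2 ^ N + 1 / 2 ^ N) ≤ _ by linarith)).trans h3
  have h8 : ξ (0 + geninv ξ x - t) ≤ ξ (geninv ξ x - t + (1 / 2 ^ N + 1 / 2 ^ N)) :=
    hξ (by linarith)
  have h9 : ξ (geninv ξ x - t - (1 / 2 ^ N + 1 / 2 ^ N)) ≤ ξ (0 + geninv ξ x - t) :=
    hξ (by linarith)
  rw [abs_le]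
  constructor <;> linarith

theorem tendsto_two_div_two_pow :
    Tendsto (fun N : ℕ => (2 : ℝ) / 2 ^ N) atTop (𝓝 0) :=
  tendsto_const_nhds.div_atTop (tendsto_pow_atTop_atTop_of_one_lt one_lt_two)

theorem ae_tendsto_increment_zero (hξ : Monotone ξ) (a : ℝ) :
    ∀ᵐ t : ℝ, Tendsto (fun N : ℕ => ξ (a - t + 2 / 2 ^ N) - ξ (a - t - 2 / 2 ^ N))
      atTop (𝓝 0) := by
  have hae : ∀ᵐ b : ℝ, ContinuousAt ξ b := hξ.countable_not_continuousAt.ae_notMem _ |>.mono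
    fun b hb => by simpa using hb
  filter_upwards [(Measure.measurePreserving_sub_left volume a).quasiMeasurePreserving.ae hae]
    with t ht
  have hadd := ht.tendsto.comp (by simpa using tendsto_two_div_two_pow.const_add (a - t))
  have hsub := ht.tendsto.comp (by simpa using tendsto_two_div_two_pow.const_sub (a - t))
  simpa using hadd.sub hsub

end Path

/-- The regularity of the paths assumed almost surely (without left limits, which are automatic
for monotone paths). -/
structure IsRegularPath (ξ : ℝ → ℝ) : Prop where
  mono : Monotone ξ
  right : ∀ s, ContinuousWithinAt ξ (Ici s) s
  top : Tendsto ξ atTop atTop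
  bot : Tendsto ξ atBot atBot

theorem ae_tendsto_increment_geninv {Ω : Type*} [MeasurableSpace Ω] (P : Measure Ω) [SFinite P]
    {X : Ω × ℝ → ℝ} (hX : Measurable X) (h : ∀ᵐ ω ∂P, IsRegularPath fun t => X (ω, t)) :
    ∀ᵐ q ∂P.prod (volume : Measure (ℝ × ℝ)),
      Tendsto (fun N : ℕ =>
        X (q.1, geninv (fun s => X (q.1, s)) q.2.1 - q.2.2 + 2 / 2 ^ N)
          - X (q.1, geninv (fun s => X (q.1, s)) q.2.1 - q.2.2 - 2 / 2 ^ N)) atTop (𝓝 0) := by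
  classical
  obtain ⟨S, hSsub, hSm, hS0⟩ := exists_measurable_superset_of_null (ae_iff.1 h)
  have hreg : ∀ ω ∉ S, IsRegularPath fun t => X (ω, t) := fun ω hω => by
    by_contra hc
    exact hω (hSsub hc)
  have hS : ∀ᵐ ω ∂P, ω ∉ S := measure_eq_zero_iff_ae_notMem.1 hS0
  let G : Ω × ℝ → ℝ := fun q => if q.1 ∈ S then 0 else geninv (fun s => X (q.1, s)) q.2
  have hG : Measurable G := by
    refine measurable_of_Iic fun s => ?_
    have hset : G ⁻¹' Iic s = {q : Ω × ℝ | q.1 ∈ S ∧ 0 ≤ s ∨ q.1 ∉ S ∧ q.2 ≤ X (q.1, s)} := by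
      ext q
      by_cases hq : q.1 ∈ S
      · simp [G, hq]
      · have := hreg _ hq
        simp [G, hq, geninv_le_iff this.mono this.right this.top this.bot]
    rw [hset]
    have hS' : MeasurableSet {q : Ω × ℝ | q.1 ∈ S} := measurable_fst hSm
    exact (hS'.inter (.const _)).union (hS'.compl.inter
      (measurableSet_le measurable_snd (by fun_prop)))
  have hae : ∀ᵐ q ∂P.prod (volume : Measure (ℝ × ℝ)),
      Tendsto (fun N : ℕ => X (q.1, G (q.1, q.2.1) - q.2.2 + 2 / 2 ^ N)
        - X (q.1, G (q.1, q.2.1) - q.2.2 - 2 / 2 ^ N)) atTop (𝓝 0) := by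
    have hmeas : MeasurableSet {q : Ω × ℝ × ℝ |
        Tendsto (fun N : ℕ => X (q.1, G (q.1, q.2.1) - q.2.2 + 2 / 2 ^ N)
          - X (q.1, G (q.1, q.2.1) - q.2.2 - 2 / 2 ^ N)) atTop (𝓝 0)} :=
      measurableSet_tendsto _ fun N => by fun_prop
    rw [Measure.ae_prod_iff_ae_ae hmeas]
    filter_upwards [hS] with ω hω
    rw [Measure.volume_eq_prod]
    refine (Measure.ae_prod_iff_ae_ae (p := fun z : ℝ × ℝ =>
      Tendsto (fun N : ℕ => X (ω, G (ω, z.1) - z.2 + 2 / 2 ^ N)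
        - X (ω, G (ω, z.1) - z.2 - 2 / 2 ^ N)) atTop (𝓝 0)) ?_).2
      (Eventually.of_forall fun x =>
        ae_tendsto_increment_zero (ξ := fun s => X (ω, s)) (hreg ω hω).mono (G (ω, x)))
    exact measurable_prodMk_left (x := ω) hmeas
  filter_upwards [hae, Measure.quasiMeasurePreserving_fst.ae hS] with q hq hqS
  simpa [G, hqS] using hq

/-- for bounded continuous `u₀`, `1 ≤ p < ∞` and compact `K ⊆ ℝ²`,
`∫_{Ω×K} |u₀(Γ^{(N)}(ω;0;x,t)) - u₀(Γ(ω;0;x,t))|^p d(P⊗λ)(ω,x,t) → 0` as `N → ∞`. -/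
theorem stmt11 {Ω : Type*} [MeasurableSpace Ω] (P : Measure Ω) [IsProbabilityMeasure P]
    (X : Ω × ℝ → ℝ) (hX : Measurable X)
    (hnice : ∀ᵐ ω ∂P,
      StrictMono (fun t => X (ω, t)) ∧
      (∀ s : ℝ, ContinuousWithinAt (fun t => X (ω, t)) (Set.Ici s) s) ∧
      (∀ s : ℝ, ∃ L : ℝ, Tendsto (fun t => X (ω, t)) (𝓝[<] s) (𝓝 L)) ∧
      Tendsto (fun t => X (ω, t)) atTop atTop ∧
      Tendsto (fun t => X (ω, t)) atBot atBot)
    (u₀ : ℝ → ℝ) (hu₀c : Continuous u₀) (hu₀b : ∃ C : ℝ, ∀ y : ℝ, |u₀ y| ≤ C)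
    (p : ℝ) (hp : 1 ≤ p) (K : Set (ℝ × ℝ)) (hK : IsCompact K) :
    Tendsto
      (fun N : ℕ =>
        ∫ q in (Set.univ : Set Ω) ×ˢ K,
          |u₀ (dyadicInterp (fun s => X (q.1, s)) N
                (0 + geninv (dyadicInterp (fun s => X (q.1, s)) N) q.2.1 - q.2.2))
              - u₀ (X (q.1, 0 + geninv (fun s => X (q.1, s)) q.2.1 - q.2.2))| ^ p
          ∂(P.prod (volume : Measure (ℝ × ℝ))))
      atTop (𝓝 0) := by
  have hreg : ∀ᵐ ω ∂P, IsRegularPath fun t => X (ω, t) := by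
    filter_upwards [hnice] with ω hω
    exact ⟨hω.1.monotone, hω.2.1, hω.2.2.2.1, hω.2.2.2.2⟩
  obtain ⟨C, hC⟩ := hu₀b
  have hp0 : 0 < p := by linarith
  have hfin : (P.prod (volume : Measure (ℝ × ℝ))) ((Set.univ : Set Ω) ×ˢ K) ≠ ⊤ := by
    simpa [Measure.prod_prod] using hK.measure_lt_top.ne
  refine tendsto_integral_zero_of_dominated (fun _ => (C + C) ^ p)
    (integrableOn_const hfin) (fun N => Eventually.of_forall fun q => ?_) (ae_restrict_of_ae ?_)
  · rw [Real.norm_of_nonneg (by positivity)]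
    gcongr
    exact (abs_sub _ _).trans (add_le_add (hC _) (hC _))
  · filter_upwards [ae_tendsto_increment_geninv P hX hreg,
      Measure.quasiMeasurePreserving_fst.ae hreg] with q hq hξ
    have hlim : Tendsto (fun N : ℕ => dyadicInterp (fun s => X (q.1, s)) N
        (0 + geninv (dyadicInterp (fun s => X (q.1, s)) N) q.2.1 - q.2.2)) atTop
        (𝓝 (X (q.1, 0 + geninv (fun s => X (q.1, s)) q.2.1 - q.2.2))) := by
      rw [tendsto_iff_dist_tendsto_zero]
      exact squeeze_zero (fun _ => dist_nonneg) (fun N =>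
        abs_dyadicInterp_geninv_sub_le hξ.mono hξ.top hξ.bot N q.2.1 q.2.2) hq
    have hu := (((hu₀c.tendsto _).comp hlim).sub_const
      (u₀ (X (q.1, 0 + geninv (fun s => X (q.1, s)) q.2.1 - q.2.2)))).abs
    simpa [Real.zero_rpow hp0.ne'] using hu.rpow_const (Or.inr hp0.le)
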